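/- For every f ∈ Δ, the element T(f) := Σ_{n≥1} (−1)^{n+1} q_n·(q_{n+1}^*(f)) (a finite sum, since q_{n+1}^*(f) = 0 once n+1 exceeds the degree of f) lies in 8Δ; consequently the operators e₁ := (1/4)·Σ_{n≥1} (−1)^{n+1} q_n q_{n+1}^* and e₀ := p₁^* − (1/4)·Σ_{n≥1} (−1)^{n+1} q_n q_{n+1}^* both map Δ into Δ. -/

import Mathlib

open MvPolynomial

noncomputable section

/-- `R = ℚ[p₁,p₃,p₅,…]`: the variable `X k` represents `p_{2k+1}`. -/
abbrev FockR : Type := MvPolynomial ℕ ℚ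

/-- `Δ = ℤ₍₂₎[p₁, 2p₃, 4p₅, …]`: the smallest subring of `R` containing all constants
with odd denominator (i.e. the image of `ℤ₍₂₎`) and the elements `2^k p_{2k+1}`. -/
def Delta : Subring FockR :=
  Subring.closure ({f | ∃ q : ℚ, Odd q.den ∧ f = C q} ∪
    {f | ∃ k : ℕ, f = (2 : FockR) ^ k * X k})

/-- `z_μ` (as a rational) for the partition with odd parts corresponding to the
exponent vector `d` (where `d k` is the multiplicity of the part `2k+1`). -/
def zExp (d : ℕ →₀ ℕ) : ℚ :=
  ∏ k ∈ d.support, ((2 * k + 1 : ℚ) ^ d k * (Nat.factorial (d k)))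

/-- The bilinear form on `R` for which the monomials `p_μ` are orthogonal with
`⟨p_μ, p_μ⟩ = z_μ`. -/
def innerP (f g : FockR) : ℚ :=
  ∑ d ∈ f.support, coeff d f * coeff d g * zExp d

/-- The exponent vector of `p_μ`: part `p = 2k+1` of `μ` contributes to the variable `X k`. -/
def toExp {n : ℕ} (μ : Nat.Partition n) : ℕ →₀ ℕ :=
  (μ.parts.map (fun p => Finsupp.single ((p - 1) / 2) 1)).sum

/-- `p_μ` as an element of `R`. -/
def pMu {n : ℕ} (μ : Nat.Partition n) : FockR := monomial (toExp μ) 1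

/-- `z_μ` for a partition `μ`. -/
def zPart {n : ℕ} (μ : Nat.Partition n) : ℚ :=
  (μ.parts.dedup.map
    (fun k => (k : ℚ) ^ μ.parts.count k * (Nat.factorial (μ.parts.count k)))).prod

/-- `q_n = Σ_{μ ⊢ n, odd parts} (2^{ℓ(μ)}/z_μ) p_μ`. -/
def qFun (n : ℕ) : FockR :=
  ∑ μ ∈ Nat.Partition.odds n, ((2 : ℚ) ^ (Multiset.card μ.parts) / zPart μ) • pMu μ

/-- The operator `p_μ^*` (composite of the `k·∂/∂p_k`), for a partition with exponent
vector `e`, given by its action on coefficients. -/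
def pStar (e : ℕ →₀ ℕ) (f : FockR) : FockR :=
  ∑ d ∈ f.support,
    (coeff d f * ∏ k ∈ e.support, ((2 * k + 1 : ℚ) ^ e k * ((d k).descFactorial (e k)))) •
      monomial (d - e) (1 : ℚ)

/-- `q_n^* = Σ_{μ ⊢ n, odd parts} (2^{ℓ(μ)}/z_μ) p_μ^*`. -/
def qStar (n : ℕ) (f : FockR) : FockR :=
  ∑ μ ∈ Nat.Partition.odds n, ((2 : ℚ) ^ (Multiset.card μ.parts) / zPart μ) • pStar (toExp μ) f

/-- `ε(n)`: 0 if `n` even, 1 if `n` odd. -/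
def eps (n : ℕ) : ℕ := n % 2

/-- `a(n)`: the largest integer `m` with `m(m+1)/2 ≤ n`. -/
def aFun (n : ℕ) : ℕ := Nat.findGreatest (fun m => m * (m + 1) ≤ 2 * n) n

/-- `T(f) = Σ_{n ≥ 1} (-1)^{n+1} q_n·(q_{n+1}^*(f))` (a finite sum); here the sum is
reindexed by `n = m + 1`, so the sign `(-1)^{n+1}` becomes `(-1)^m`. -/
def Tope (f : FockR) : FockR :=
  ∑ᶠ m : ℕ, ((-1 : ℚ) ^ m) • (qFun (m + 1) * qStar (m + 2) f)


def wt : (ℕ →₀ ℕ) →+ ℕ := Finsupp.weight (fun k : ℕ => k)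

lemma wt_single (k m : ℕ) : wt (Finsupp.single k m) = m * k := by
  simp [wt, Finsupp.weight_single]

def LL : Subring ℚ := Delta.comap (C : ℚ →+* FockR)

lemma mem_LL {c : ℚ} : c ∈ LL ↔ C c ∈ Delta := Iff.rfl

lemma smul_mem_Delta {c : ℚ} (hc : c ∈ LL) {f : FockR} (hf : f ∈ Delta) : c • f ∈ Delta := by
  rw [MvPolynomial.smul_eq_C_mul]
  exact Delta.mul_mem (mem_LL.1 hc) hf

lemma nat_mem_LL (n : ℕ) : (n : ℚ) ∈ LL := natCast_mem _ n

lemma two_pow_mem_LL (n : ℕ) : (2 : ℚ) ^ n ∈ LL := pow_mem (by simpa using nat_mem_LL 2) n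

lemma inv_mem_LL {b : ℕ} (hb : Odd b) : (b : ℚ)⁻¹ ∈ LL := by
  apply Subring.subset_closure
  left
  refine ⟨_, ?_, rfl⟩
  rw [Rat.inv_natCast_den]
  split_ifs
  · exact odd_one
  · exact hb

lemma mono_mem (d : ℕ →₀ ℕ) : (monomial d ((2 : ℚ) ^ wt d) : FockR) ∈ Delta := by
  induction d using Finsupp.induction_linear with
  | zero => simpa using Delta.one_mem
  | add f g hf hg =>
    have := Delta.mul_mem hf hg
    rwa [monomial_mul, ← pow_add, ← map_add] at this
  | single k m =>
    have h : ((2 : FockR) ^ k * X k) ∈ Delta := Subring.subset_closure (Or.inr ⟨k, rfl⟩)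
    have := Delta.pow_mem h m
    rw [wt_single]
    convert this using 1
    have h2 : (2 : FockR) = C 2 := (map_ofNat C 2).symm
    rw [mul_pow, X_pow_eq_monomial, h2, ← pow_mul, ← C_pow, C_mul_monomial, mul_one, mul_comm]

lemma coeff_of_mem {f : FockR} (hf : f ∈ Delta) :
    ∀ d, ∃ c ∈ LL, coeff d f = c * 2 ^ wt d := by
  induction hf using Subring.closure_induction with
  | mem x hx =>
    intro d
    rcases hx with ⟨q, hq, rfl⟩ | ⟨k, rfl⟩
    · rw [coeff_C]
      split_ifs with h
      · subst h
        exact ⟨q, Subring.subset_closure (Or.inl ⟨q, hq, rfl⟩), by simp⟩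
      · exact ⟨0, LL.zero_mem, by simp⟩
    · have h2 : (2 : FockR) = C 2 := (map_ofNat C 2).symm
      rw [h2, ← C_pow, coeff_C_mul, coeff_X']
      split_ifs with h
      · subst h
        exact ⟨1, LL.one_mem, by simp [wt_single]⟩
      · exact ⟨0, LL.zero_mem, by simp⟩
  | zero => exact fun d => ⟨0, LL.zero_mem, by simp⟩
  | one =>
    intro d
    rw [coeff_one]
    split_ifs with h
    · subst h
      exact ⟨1, LL.one_mem, by simp⟩
    · exact ⟨0, LL.zero_mem, by simp⟩
  | add x y _ _ hx hy =>
    intro d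
    obtain ⟨a, ha, ha'⟩ := hx d
    obtain ⟨b, hb, hb'⟩ := hy d
    exact ⟨a + b, LL.add_mem ha hb, by rw [coeff_add, ha', hb']; ring⟩
  | neg x _ hx =>
    intro d
    obtain ⟨a, ha, ha'⟩ := hx d
    exact ⟨-a, LL.neg_mem ha, by rw [coeff_neg, ha']; ring⟩
  | mul x y _ _ hx hy =>
    intro d
    choose a ha ha' using hx
    choose b hb hb' using hy
    refine ⟨∑ p ∈ Finset.HasAntidiagonal.antidiagonal d, a p.1 * b p.2,
      LL.sum_mem fun p _ => LL.mul_mem (ha _) (hb _), ?_⟩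
    rw [coeff_mul, Finset.sum_mul]
    refine Finset.sum_congr rfl fun p hp => ?_
    rw [← Finset.HasAntidiagonal.mem_antidiagonal.1 hp, ha', hb', map_add, pow_add]
    ring

lemma zExp_ne (e : ℕ →₀ ℕ) : zExp e ≠ 0 := by
  unfold zExp
  refine Finset.prod_ne_zero_iff.2 fun k _ => ?_
  positivity

lemma pStar_mem {f : FockR} (hf : f ∈ Delta) (e : ℕ →₀ ℕ) :
    ∃ g ∈ Delta, pStar e f = (zExp e * 2 ^ wt e) • g := by
  choose c hc hc' using coeff_of_mem hf
  refine ⟨∑ d ∈ f.support, (c d * ∏ k ∈ e.support, ((d k).choose (e k) : ℚ)) •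
      monomial (d - e) ((2 : ℚ) ^ wt (d - e)),
    Delta.sum_mem fun d _ => smul_mem_Delta
      (LL.mul_mem (hc d) (LL.prod_mem fun k _ => nat_mem_LL _)) (mono_mem _), ?_⟩
  unfold pStar
  rw [Finset.smul_sum]
  refine Finset.sum_congr rfl fun d _ => ?_
  have key : (∏ k ∈ e.support, ((2 * k + 1 : ℚ) ^ e k * ((d k).descFactorial (e k))))
      = zExp e * ∏ k ∈ e.support, ((d k).choose (e k) : ℚ) := by
    rw [zExp, ← Finset.prod_mul_distrib]
    refine Finset.prod_congr rfl fun k _ => ?_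
    rw [Nat.descFactorial_eq_factorial_mul_choose]
    push_cast
    ring
  rw [key]
  by_cases h : e ≤ d
  · have hw : wt d = wt (d - e) + wt e := by
      rw [← map_add, tsub_add_cancel_of_le h]
    simp only [smul_monomial, smul_eq_mul]
    congr 1
    rw [hc', hw, pow_add]
    ring
  · have hz : ∏ k ∈ e.support, ((d k).choose (e k) : ℚ) = 0 := by
      rw [Finsupp.le_def] at h
      push Not at h
      obtain ⟨k, hk⟩ := h
      refine Finset.prod_eq_zero (i := k) (by simp; omega) ?_
      rw [Nat.choose_eq_zero_of_lt hk]
      simp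
    rw [hz]
    simp

lemma two_fact (m : ℕ) (hm : m ≠ 0) : ∃ c ∈ LL, (2 : ℚ) ^ m / (m.factorial : ℚ) = 2 * c := by
  obtain ⟨v, b, hb, h⟩ := Nat.exists_eq_two_pow_mul_odd (Nat.factorial_ne_zero m)
  have hv : v < m := by
    have h1 := Nat.emultiplicity_two_factorial_lt hm
    have h2 : ((v : ℕ) : ℕ∞) ≤ emultiplicity 2 m.factorial :=
      le_emultiplicity_of_pow_dvd ⟨b, h⟩
    exact_mod_cast lt_of_le_of_lt h2 h1
  refine ⟨2 ^ (m - v - 1) * (b : ℚ)⁻¹, LL.mul_mem (two_pow_mem_LL _) (inv_mem_LL hb), ?_⟩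
  have hb0 : (b : ℚ) ≠ 0 := by
    have := hb.pos
    positivity
  have hm' : m = v + 1 + (m - v - 1) := by omega
  rw [h]
  push_cast
  conv_lhs => rw [hm']
  have : v + 1 + (m - v - 1) - v - 1 = m - v - 1 := by omega
  field_simp
  rw [pow_add, pow_add]
  ring

lemma two_pow_div_zExp (e : ℕ →₀ ℕ) (he : e ≠ 0) :
    ∃ c ∈ LL, (2 : ℚ) ^ (e.degree) / zExp e = 2 * c := by
  have h : (2 : ℚ) ^ (e.degree) / zExp e =
      ∏ k ∈ e.support, ((((2 * k + 1) ^ e k : ℕ) : ℚ)⁻¹ * (2 ^ e k / (e k).factorial)) := by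
    rw [Finsupp.degree_apply, ← Finset.prod_pow_eq_pow_sum, zExp, ← Finset.prod_div_distrib]
    refine Finset.prod_congr rfl fun k _ => ?_
    push_cast
    field_simp
  have hL : ∀ k ∈ e.support, ∃ c ∈ LL,
      ((((2 * k + 1) ^ e k : ℕ) : ℚ)⁻¹ * (2 ^ e k / (e k).factorial)) = 2 * c := by
    intro k hk
    obtain ⟨c, hc, h⟩ := two_fact (e k) (by simpa using hk)
    refine ⟨(((2 * k + 1) ^ e k : ℕ) : ℚ)⁻¹ * c, LL.mul_mem (inv_mem_LL ?_) hc, ?_⟩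
    · exact Odd.pow ⟨k, rfl⟩
    · rw [h]; ring
  obtain ⟨k, hk⟩ := Finsupp.support_nonempty_iff.2 he
  obtain ⟨c, hc, h'⟩ := hL k hk
  rw [h, ← Finset.mul_prod_erase _ _ hk, h', mul_assoc]
  refine ⟨_, LL.mul_mem hc (LL.prod_mem fun j hj => ?_), rfl⟩
  obtain ⟨c, hc, h''⟩ := hL j (Finset.mem_of_mem_erase hj)
  rw [h'']
  exact LL.mul_mem (by simpa using nat_mem_LL 2) hc

lemma toExp_eq {n : ℕ} (μ : Nat.Partition n) :
    toExp μ = Multiset.toFinsupp (μ.parts.map fun p => (p - 1) / 2) := by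
  unfold toExp
  induction μ.parts using Multiset.induction_on with
  | empty => simp
  | cons a s ih =>
    rw [Multiset.map_cons, Multiset.sum_cons, ih, Multiset.map_cons, ← Multiset.singleton_add,
      map_add, Multiset.toFinsupp_singleton]

lemma part_facts {n : ℕ} (μ : Nat.Partition n) (hμ : μ ∈ Nat.Partition.odds n) :
    zPart μ = zExp (toExp μ) ∧ Multiset.card μ.parts = (toExp μ).degree ∧
    n = 2 * wt (toExp μ) + (toExp μ).degree := by
  have hodd : ∀ p ∈ μ.parts, Odd p := by
    intro p hp
    have := (Finset.mem_filter.1 hμ).2 p hp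
    simpa using this
  obtain ⟨s, hs⟩ : ∃ s, s = μ.parts.map fun p => (p - 1) / 2 := ⟨_, rfl⟩
  have hp : μ.parts = s.map (fun k => 2 * k + 1) := by
    rw [hs, Multiset.map_map]
    conv_lhs => rw [← Multiset.map_id μ.parts]
    refine Multiset.map_congr rfl fun p hp => ?_
    obtain ⟨k, rfl⟩ := hodd p hp
    simp
  have hinj : Function.Injective (fun k : ℕ => 2 * k + 1) := by
    intro a b h
    simp at h
    exact h
  rw [toExp_eq, ← hs]
  have hdeg : ∀ s : Multiset ℕ, Multiset.card s = (Multiset.toFinsupp s).degree := by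
    intro s
    induction s using Multiset.induction_on with
    | empty => simp
    | cons a s ih =>
      rw [← Multiset.singleton_add, map_add, map_add, Multiset.toFinsupp_singleton, ← ih]
      simp [add_comm]
  refine ⟨?_, ?_, ?_⟩
  · have hcast : ∀ t : Multiset ℕ, (do let a ← t; pure (a : ℚ) : Multiset ℚ) =
        t.map (fun a : ℕ => (a : ℚ)) := by
      intro t
      exact Multiset.bind_singleton _ _
    have hcinj : Function.Injective (fun a : ℕ => (a : ℚ)) := Nat.cast_injective
    unfold zPart zExp
    rw [hcast, hcast, hp, Multiset.dedup_map_of_injective hinj, Multiset.map_map,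
      Multiset.map_map, Multiset.toFinsupp_support]
    rw [Finset.prod]
    congr 1
    refine Multiset.map_congr rfl fun k _ => ?_
    simp only [Function.comp, Multiset.toFinsupp_apply]
    rw [Multiset.count_map_eq_count' _ _ hcinj, Multiset.count_map_eq_count' _ _ hinj]
    push_cast
    rfl
  · rw [hp, Multiset.card_map, hdeg]
  · have h : ∀ s : Multiset ℕ, (s.map (fun k => 2 * k + 1)).sum =
        2 * wt (Multiset.toFinsupp s) + (Multiset.toFinsupp s).degree := by
      intro s
      induction s using Multiset.induction_on with
      | empty => simp
      | cons a s ih =>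
        rw [Multiset.map_cons, Multiset.sum_cons, ih, ← Multiset.singleton_add, map_add, map_add,
          map_add, Multiset.toFinsupp_singleton, wt_single]
        simp
        ring
    rw [← h, ← hp, μ.parts_sum]

lemma toExp_ne {n : ℕ} (hn : n ≠ 0) (μ : Nat.Partition n) (hμ : μ ∈ Nat.Partition.odds n) :
    toExp μ ≠ 0 := by
  intro h
  have := (part_facts μ hμ).2.2
  rw [h] at this
  simp at this
  exact hn this

lemma qFun_mem (m : ℕ) : ∃ g ∈ Delta, (2 : ℚ) ^ (m / 2) • qFun (m + 1) = (2 : ℚ) • g := by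
  have : ∀ μ ∈ Nat.Partition.odds (m + 1), ∃ g ∈ Delta,
      (2 : ℚ) ^ (m / 2) • ((2 : ℚ) ^ (Multiset.card μ.parts) / zPart μ) • pMu μ = (2 : ℚ) • g := by
    intro μ hμ
    obtain ⟨h1, h2, h3⟩ := part_facts μ hμ
    have hne := toExp_ne (Nat.succ_ne_zero m) μ hμ
    have hd : (toExp μ).degree ≠ 0 := by rwa [Ne, Finsupp.degree_eq_zero_iff]
    obtain ⟨c, hc, h⟩ := two_pow_div_zExp _ hne
    have hw : m / 2 = (m / 2 - wt (toExp μ)) + wt (toExp μ) := by omega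
    refine ⟨(c * 2 ^ (m / 2 - wt (toExp μ))) • monomial (toExp μ) ((2 : ℚ) ^ wt (toExp μ)),
      smul_mem_Delta (LL.mul_mem hc (two_pow_mem_LL _)) (mono_mem _), ?_⟩
    rw [h1, h2, h, pMu, hw, pow_add]
    simp only [smul_monomial, smul_eq_mul, Nat.add_sub_cancel]
    congr 1
    ring
  choose! g hg hg' using this
  refine ⟨∑ μ ∈ Nat.Partition.odds (m + 1), g μ, Delta.sum_mem hg, ?_⟩
  rw [qFun, Finset.smul_sum, Finset.smul_sum]
  exact Finset.sum_congr rfl hg'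

lemma qStar_mem {f : FockR} (hf : f ∈ Delta) (m : ℕ) :
    ∃ g ∈ Delta, qStar (m + 2) f = (2 : ℚ) ^ (m / 2 + 2) • g := by
  have : ∀ μ ∈ Nat.Partition.odds (m + 2), ∃ g ∈ Delta,
      ((2 : ℚ) ^ (Multiset.card μ.parts) / zPart μ) • pStar (toExp μ) f =
        (2 : ℚ) ^ (m / 2 + 2) • g := by
    intro μ hμ
    obtain ⟨h1, h2, h3⟩ := part_facts μ hμ
    have hne := toExp_ne (Nat.succ_ne_zero (m + 1)) μ hμ
    have hd : (toExp μ).degree ≠ 0 := by rwa [Ne, Finsupp.degree_eq_zero_iff]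
    obtain ⟨g, hg, hg'⟩ := pStar_mem hf (toExp μ)
    have hw : (toExp μ).degree + wt (toExp μ) =
      (m / 2 + 2) + ((toExp μ).degree + wt (toExp μ) - (m / 2 + 2)) := by omega
    refine ⟨(2 : ℚ) ^ ((toExp μ).degree + wt (toExp μ) - (m / 2 + 2)) • g,
      smul_mem_Delta (two_pow_mem_LL _) hg, ?_⟩
    rw [h1, h2, hg', smul_smul, smul_smul, ← pow_add, ← hw, pow_add]
    congr 1
    have := zExp_ne (toExp μ)
    field_simp
  choose! g hg hg' using this
  refine ⟨∑ μ ∈ Nat.Partition.odds (m + 2), g μ, Delta.sum_mem hg, ?_⟩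
  rw [qStar, Finset.smul_sum]
  exact Finset.sum_congr rfl hg'

lemma Tope_mem {f : FockR} (hf : f ∈ Delta) : ∃ g ∈ Delta, Tope f = (8 : ℚ) • g := by
  unfold Tope
  refine finsum_induction (fun x => ∃ g ∈ Delta, x = (8 : ℚ) • g) ⟨0, Delta.zero_mem, by simp⟩
    ?_ ?_
  · rintro _ _ ⟨a, ha, rfl⟩ ⟨b, hb, rfl⟩
    exact ⟨a + b, Delta.add_mem ha hb, by rw [smul_add]⟩
  · intro m
    obtain ⟨a, ha, ha'⟩ := qFun_mem m
    obtain ⟨b, hb, hb'⟩ := qStar_mem hf m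
    refine ⟨((-1 : ℚ) ^ m) • (a * b),
      smul_mem_Delta (LL.pow_mem (LL.neg_mem LL.one_mem) m) (Delta.mul_mem ha hb), ?_⟩
    rw [hb', pow_add, mul_comm ((2 : ℚ) ^ (m / 2)), ← smul_smul, mul_smul_comm, mul_smul_comm,
      ← smul_mul_assoc ((2 : ℚ) ^ (m / 2)), ha', smul_mul_assoc, smul_smul, smul_smul, smul_smul]
    congr 1
    ring

/-- For every `f ∈ Δ`, `T(f)` lies in `8Δ`; consequently the operators
`e₁ = (1/4)Σ_{n≥1}(-1)^{n+1} q_n q_{n+1}^*` and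
`e₀ = p₁^* - (1/4)Σ_{n≥1}(-1)^{n+1} q_n q_{n+1}^*` both map `Δ` into `Δ`.
(Here `p₁^* = ∂/∂p₁` is `pStar` of the exponent vector of `p₁`.) -/
theorem e0_e1_preserve_Delta (f : FockR) (hf : f ∈ Delta) :
    (∃ g ∈ Delta, Tope f = 8 * g) ∧
    (1 / 4 : ℚ) • Tope f ∈ Delta ∧
    pStar (Finsupp.single 0 1) f - (1 / 4 : ℚ) • Tope f ∈ Delta := by
  obtain ⟨g, hg, h⟩ := Tope_mem hf
  have h4 : (1 / 4 : ℚ) • Tope f ∈ Delta := by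
    rw [h, smul_smul]
    exact smul_mem_Delta (by norm_num) hg
  refine ⟨⟨g, hg, ?_⟩, h4, Delta.sub_mem ?_ h4⟩
  · rw [h, MvPolynomial.smul_eq_C_mul, map_ofNat C 8]
  · obtain ⟨g', hg', h'⟩ := pStar_mem hf (Finsupp.single 0 1)
    rw [h']
    refine smul_mem_Delta ?_ hg'
    have : zExp (Finsupp.single 0 1) = 1 := by
      unfold zExp
      rw [Finsupp.support_single_ne_zero _ one_ne_zero]
      simp
    rw [this, wt_single]
    simpa using LL.one_mem

end
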